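/- Let n ≥ 2 and m ≥ 1 be integers and let ζ_n = exp(2πi/n). Then 𝔷_n(ζ_n; m, 2) = (1/n)·C(n, m+1)·∑_{k=0}^{m} ∑_{m+1 ≤ i_1 < i_2 < ⋯ < i_{k+1} ≤ 2m+1} (−n)^k/(i_1 i_2 ⋯ i_{k+1}), where the inner sum is over strictly increasing (k+1)-tuples of integers between m+1 and 2m+1, and C(n, m+1) denotes the binomial coefficient. -/

import Mathlib

/-- The primitive `n`-th root of unity `ζ_n = exp(2πi/n)`. -/
noncomputable def zetaN (n : ℕ) : ℂ := Complex.exp (2 * Real.pi * Complex.I / n)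

/-- The finite `q`-multiple zeta value `𝔷_n(ζ_n; m, s)`. -/
noncomputable def zmzv (n m s : ℕ) : ℂ :=
  ∑ T ∈ (Finset.Icc 1 (n - 1)).powersetCard m,
    (∏ i ∈ T, (1 - zetaN n ^ i) ^ s)⁻¹

open Polynomial

/-- The coefficients of `∏ (1 + f i X)` are the elementary symmetric functions of the `f i`. -/
lemma coeff_prod_one_add_C_mul_X {ι R : Type*} [CommRing R] (s : Finset ι) (f : ι → R) (m : ℕ) :
    (∏ i ∈ s, (1 + C (f i) * X)).coeff m = ∑ T ∈ s.powersetCard m, ∏ i ∈ T, f i := by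
  rw [Finset.prod_one_add, finsetSum_coeff, Finset.powersetCard_eq_filter, Finset.sum_filter]
  refine Finset.sum_congr rfl fun T _ => ?_
  rw [Finset.prod_mul_distrib, Finset.prod_const, ← map_prod, coeff_C_mul, coeff_X_pow]
  simp [eq_comm]

lemma coeff_one_sub_X_pow {R : Type*} [CommRing R] (n k : ℕ) :
    ((1 - X : R[X]) ^ n).coeff k = (-1) ^ k * (n.choose k : R) := by
  have h : (1 - X : R[X]) ^ n = ((1 + X) ^ n).comp (C (-1) * X) := by simp [sub_eq_add_neg]
  rw [h, comp_C_mul_X_coeff, coeff_one_add_X_pow, mul_comm]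

lemma cast_choose_succ_mul {R : Type*} [CommRing R] (n k : ℕ) :
    (n.choose (k + 1) : R) * (k + 1) = n.choose k * ((n : R) - k) := by
  have h := congrArg (Nat.cast (R := R)) (Nat.choose_succ_right_eq n k)
  push_cast at h
  rw [h]
  rcases le_or_gt k n with hk | hk
  · rw [Nat.cast_sub hk]
  · simp [Nat.choose_eq_zero_of_lt hk]

lemma choose_mul_prod_one_sub_div {K : Type*} [Field K] [CharZero K] (n a r : ℕ) (ha : a ≠ 0) :
    (a : K) * n.choose a * ∏ i ∈ Finset.Ico a (a + r), (1 + -(n : K) / i) =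
      (-1) ^ r * (a + r : ℕ) * n.choose (a + r) := by
  induction r with
  | zero => simp
  | succ r ih =>
    have h0 : ((a + r : ℕ) : K) ≠ 0 := Nat.cast_ne_zero.mpr (by omega)
    have h := cast_choose_succ_mul (R := K) n (a + r)
    rw [← add_assoc, Finset.prod_Ico_succ_top (by omega), ← mul_assoc, ih, pow_succ]
    rw [Nat.cast_succ (a + r)]
    field_simp
    linear_combination h

/-- The factorization of `((1 + X) ^ n - 1) / X` attached to a primitive `n`-th root of unity. -/
lemma IsPrimitiveRoot.one_add_X_pow_sub_one {K : Type*} [Field K] {n : ℕ} {ζ : K}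
    (hζ : IsPrimitiveRoot ζ n) (hn : 0 < n) :
    (1 + X : K[X]) ^ n - 1 =
      C (n : K) * X * ∏ i ∈ Finset.Icc 1 (n - 1), (1 + C ((1 - ζ ^ i)⁻¹) * X) := by
  have hx : ∀ i ∈ Finset.Icc 1 (n - 1), 1 - ζ ^ i ≠ 0 := fun i hi => by
    rw [Finset.mem_Icc] at hi
    exact sub_ne_zero.mpr (hζ.pow_ne_one_of_pos_of_lt (by omega) (by omega)).symm
  have h1 : (1 + X : K[X]) ^ n - 1 = C (∏ i ∈ Finset.Icc 1 (n - 1), (1 - ζ ^ i)) * X *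
      ∏ i ∈ Finset.Icc 1 (n - 1), (1 + C ((1 - ζ ^ i)⁻¹) * X) := by
    have h := congrArg (fun p : K[X] => p.comp (1 + X))
      (X_pow_sub_C_eq_prod hζ hn (one_pow n : (1 : K) ^ n = 1))
    simp only [sub_comp, pow_comp, X_comp, C_comp, prod_comp, mul_one, C_1, one_comp] at h
    have hIco : Finset.Icc 1 (n - 1) = Finset.Ico 1 n := by ext; simp; omega
    rw [h, Finset.range_eq_Ico, Finset.prod_eq_prod_Ico_succ_bot hn, ← hIco, mul_right_comm,
      map_prod, ← Finset.prod_mul_distrib, mul_comm]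
    congr 1
    · refine Finset.prod_congr rfl fun i hi => ?_
      rw [mul_add, ← mul_assoc, ← C_mul, mul_inv_cancel₀ (hx i hi)]
      simp
      ring
    · simp
  have h2 := congrArg (fun p : K[X] => p.coeff 1) h1
  simp only [mul_right_comm _ X, coeff_mul_X, coeff_sub, coeff_one_add_X_pow, coeff_C_mul,
    coeff_prod_one_add_C_mul_X, coeff_one, Nat.choose_one_right] at h2
  have h3 : ∏ i ∈ Finset.Icc 1 (n - 1), (1 - ζ ^ i) = (n : K) := by simpa using h2.symm
  rw [h1, h3]

/-- Coefficient comparison in `P(X) P(-X)` for `P = ∏ (1 + X / (1 - ζ ^ i))`. -/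
lemma IsPrimitiveRoot.sq_mul_sum_prod_inv_sq {K : Type*} [Field K] {n : ℕ} {ζ : K}
    (hζ : IsPrimitiveRoot ζ n) (hn : 0 < n) (m : ℕ) :
    (n : K) ^ 2 * ∑ T ∈ (Finset.Icc 1 (n - 1)).powersetCard m, (∏ i ∈ T, (1 - ζ ^ i) ^ 2)⁻¹ =
      n.choose (m + 1) + 2 * (-1) ^ m * n.choose (2 * m + 2) := by
  have hp := hζ.one_add_X_pow_sub_one hn
  have hq := congrArg (fun p : K[X] => p.comp (-X)) hp
  simp only [sub_comp, pow_comp, add_comp, one_comp, X_comp, mul_comp, C_comp, prod_comp,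
    ← sub_eq_add_neg] at hq
  have key : expand K 2 ((1 - X) ^ n) - (1 + X) ^ n - (1 - X) ^ n + 1 =
      C (-(n : K) ^ 2) * expand K 2 (∏ i ∈ Finset.Icc 1 (n - 1),
        (1 + C (-((1 - ζ ^ i)⁻¹) ^ 2) * X)) * X ^ 2 := by
    have hL : expand K 2 ((1 - X) ^ n) = (1 + X : K[X]) ^ n * (1 - X) ^ n := by
      rw [← mul_pow]; simp only [map_pow, map_sub, map_one, expand_X]; ring
    have hR : expand K 2 (∏ i ∈ Finset.Icc 1 (n - 1), (1 + C (-((1 - ζ ^ i)⁻¹) ^ 2) * X)) =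
        (∏ i ∈ Finset.Icc 1 (n - 1), (1 + C ((1 - ζ ^ i)⁻¹) * X)) *
          ∏ i ∈ Finset.Icc 1 (n - 1), (1 + C ((1 - ζ ^ i)⁻¹) * -X) := by
      rw [map_prod, ← Finset.prod_mul_distrib]
      refine Finset.prod_congr rfl fun i _ => ?_
      simp only [map_add, map_one, map_mul, map_neg, map_pow, expand_X, expand_C]
      ring
    rw [hL, hR, C_neg, C_pow]
    linear_combination ((1 - X : K[X]) ^ n - 1) * hp + C (n : K) * X *
      (∏ i ∈ Finset.Icc 1 (n - 1), (1 + C ((1 - ζ ^ i)⁻¹) * X)) * hq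
  have h := congrArg (fun p : K[X] => p.coeff (2 * m + 2)) key
  simp only [coeff_mul_X_pow, coeff_add, coeff_sub, coeff_C_mul, coeff_one_add_X_pow,
    coeff_one_sub_X_pow, coeff_one] at h
  rw [show 2 * m + 2 = (m + 1) * 2 by ring, coeff_expand_mul (by norm_num), mul_comm 2 m,
    coeff_expand_mul (by norm_num), coeff_prod_one_add_C_mul_X, coeff_one_sub_X_pow] at h
  have hs : ∑ T ∈ (Finset.Icc 1 (n - 1)).powersetCard m, ∏ i ∈ T, -((1 - ζ ^ i)⁻¹) ^ 2 =
      (-1) ^ m *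
        ∑ T ∈ (Finset.Icc 1 (n - 1)).powersetCard m, (∏ i ∈ T, (1 - ζ ^ i) ^ 2)⁻¹ := by
    rw [Finset.mul_sum]
    refine Finset.sum_congr rfl fun T hT => ?_
    rw [Finset.prod_neg, (Finset.mem_powersetCard.mp hT).2, ← Finset.prod_inv_distrib]
    simp only [inv_pow]
  rw [hs, if_neg (by omega), pow_mul' _ _ 2, neg_one_sq, one_pow, pow_succ] at h
  rw [show 2 * m + 2 = (m + 1) * 2 by ring]
  have hm : ((-1 : K) ^ m) * (-1) ^ m = 1 := by rw [← mul_pow]; simp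
  linear_combination ((-1 : K) ^ m) * h + (n.choose (m + 1) - (n : K) ^ 2 *
    ∑ T ∈ (Finset.Icc 1 (n - 1)).powersetCard m, (∏ i ∈ T, (1 - ζ ^ i) ^ 2)⁻¹) * hm

theorem stmt11 (n m : ℕ) (hn : 2 ≤ n) (hm : 1 ≤ m) :
    zmzv n m 2 =
      (1 / (n : ℂ)) * (n.choose (m + 1) : ℂ) *
        ∑ k ∈ Finset.range (m + 1),
          ∑ T ∈ (Finset.Icc (m + 1) (2 * m + 1)).powersetCard (k + 1),
            (-(n : ℂ)) ^ k / ∏ i ∈ T, (i : ℂ) := by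
  have hn0 : (n : ℂ) ≠ 0 := Nat.cast_ne_zero.mpr (by omega)
  have hζ : IsPrimitiveRoot (zetaN n) n := Complex.isPrimitiveRoot_exp n (by omega)
  have hz := hζ.sq_mul_sum_prod_inv_sq (by omega) m
  have hsum : ∏ i ∈ Finset.Icc (m + 1) (2 * m + 1), (1 + -(n : ℂ) / i) =
      1 - n * ∑ k ∈ Finset.range (m + 1),
          ∑ T ∈ (Finset.Icc (m + 1) (2 * m + 1)).powersetCard (k + 1),
            (-(n : ℂ)) ^ k / ∏ i ∈ T, (i : ℂ) := by
    have hcard : (Finset.Icc (m + 1) (2 * m + 1)).card = m + 1 := by simp; omega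
    rw [Finset.prod_one_add, Finset.sum_powerset, hcard, Finset.sum_range_succ',
      Finset.powersetCard_zero, Finset.sum_singleton, Finset.prod_empty, sub_eq_neg_add,
      ← neg_mul, Finset.mul_sum]
    congr 1
    refine Finset.sum_congr rfl fun k _ => ?_
    rw [Finset.mul_sum]
    refine Finset.sum_congr rfl fun T hT => ?_
    rw [Finset.prod_div_distrib, Finset.prod_const, (Finset.mem_powersetCard.mp hT).2]
    ring
  have hprod := choose_mul_prod_one_sub_div (K := ℂ) n (m + 1) (m + 1) (by omega)
  have hIcc : Finset.Ico (m + 1) (m + 1 + (m + 1)) = Finset.Icc (m + 1) (2 * m + 1) := by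
    ext; simp; omega
  have hm0 : (m : ℂ) + 1 ≠ 0 := Nat.cast_add_one_ne_zero m
  rw [hIcc, hsum, show m + 1 + (m + 1) = 2 * m + 2 by ring] at hprod
  push_cast at hprod
  rw [zmzv]
  apply mul_left_cancel₀ (pow_ne_zero 2 hn0)
  apply mul_left_cancel₀ hm0
  rw [hz]
  rw [pow_succ] at hprod
  have hinv : (n : ℂ) ^ 2 * (1 / n) = n := by field_simp
  rw [mul_assoc (1 / (n : ℂ)), ← mul_assoc ((n : ℂ) ^ 2), hinv]
  linear_combination hprod
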